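/- The number of knot (6,6)-mosaics is D_{6,6} = 101393411126. -/

import Mathlib

/-- The eleven mosaic tiles `T₀, …, T₁₀`. -/
inductive Tile : Type
  | T0 | T1 | T2 | T3 | T4 | T5 | T6 | T7 | T8 | T9 | T10
  deriving DecidableEq

namespace Tile

/-- Whether the top edge of a tile carries a connection point.
`T0` has no connection points; `T1,…,T6` realize the six unordered pairs of edges
(`T1`: bottom–left, `T2`: bottom–right, `T3`: top–right, `T4`: top–left,
`T5`: left–right, `T6`: top–bottom); `T7,…,T10` have all four. -/
def top : Tile → Bool
  | .T3 | .T4 | .T6 | .T7 | .T8 | .T9 | .T10 => true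
  | _ => false

/-- Whether the bottom edge of a tile carries a connection point. -/
def bottom : Tile → Bool
  | .T1 | .T2 | .T6 | .T7 | .T8 | .T9 | .T10 => true
  | _ => false

/-- Whether the left edge of a tile carries a connection point. -/
def left : Tile → Bool
  | .T1 | .T4 | .T5 | .T7 | .T8 | .T9 | .T10 => true
  | _ => false

/-- Whether the right edge of a tile carries a connection point. -/
def right : Tile → Bool
  | .T2 | .T3 | .T5 | .T7 | .T8 | .T9 | .T10 => true
  | _ => false

end Tile

/-- An `(m,n)`-mosaic `M : Fin m → Fin n → Tile` (rows indexed top-to-bottom,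
columns left-to-right) is suitably connected if any pair of contiguous tiles
have or do not have connection points simultaneously on their common edge. -/
def SuitablyConnected {m n : ℕ} (M : Fin m → Fin n → Tile) : Prop :=
  (∀ (i : Fin m) (j : Fin n) (h : (j : ℕ) + 1 < n),
    (M i j).right = (M i ⟨(j : ℕ) + 1, h⟩).left) ∧
  (∀ (i : Fin m) (j : Fin n) (h : (i : ℕ) + 1 < m),
    (M i j).bottom = (M ⟨(i : ℕ) + 1, h⟩ j).top)

/-- None of the boundary edges of the mosaic carries a connection point. -/
def BoundaryFree {m n : ℕ} (M : Fin m → Fin n → Tile) : Prop :=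
  ∀ (i : Fin m) (j : Fin n),
    ((i : ℕ) = 0 → (M i j).top = false) ∧
    ((i : ℕ) = m - 1 → (M i j).bottom = false) ∧
    ((j : ℕ) = 0 → (M i j).left = false) ∧
    ((j : ℕ) = n - 1 → (M i j).right = false)

/-- A knot `(m,n)`-mosaic is a suitably connected mosaic none of whose boundary
edges has a connection point. -/
def IsKnotMosaic {m n : ℕ} (M : Fin m → Fin n → Tile) : Prop :=
  SuitablyConnected M ∧ BoundaryFree M

/-- `D m n`, the number of knot `(m,n)`-mosaics. -/
noncomputable def knotMosaicCount (m n : ℕ) : ℕ :=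
  Nat.card {M : Fin m → Fin n → Tile // IsKnotMosaic M}

/-- `|Q^{(p,q)}|`, the number of `(p,q)`-quasimosaics (suitably connected
`(p,q)`-mosaics, with connection points allowed on boundary edges). -/
noncomputable def quasimosaicCount (p q : ℕ) : ℕ :=
  Nat.card {M : Fin p → Fin q → Tile // SuitablyConnected M}

/-- `IsTileChain inn out a b x` says that the sequence `x` can be run from state `a` to state `b`,
where the element `x i` leads from the state `inn (x i)` to the state `out (x i)`. -/
def IsTileChain {α σ : Type*} (inn out : α → σ) : {n : ℕ} → σ → σ → (Fin n → α) → Prop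
  | 0, a, b, _ => a = b
  | _ + 1, a, b, x => inn (x 0) = a ∧ IsTileChain inn out (out (x 0)) b (Fin.tail x)

theorem isTileChain_succ_iff {α σ : Type*} (inn out : α → σ) (b : σ) {n : ℕ} (a : σ)
    (x : Fin (n + 1) → α) :
    IsTileChain inn out a b x ↔
      inn (x 0) = a ∧ (∀ i : Fin n, out (x i.castSucc) = inn (x i.succ)) ∧
        out (x (Fin.last n)) = b := by
  induction n generalizing a with
  | zero => simp [IsTileChain]
  | succ n ih =>
    rw [IsTileChain, ih, Fin.forall_fin_succ]
    simp only [Fin.tail, Fin.succ_last, Fin.castSucc_zero, ← Fin.succ_castSucc]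
    constructor
    · rintro ⟨h, h₀, h₁, h₂⟩
      exact ⟨h, ⟨h₀.symm, h₁⟩, h₂⟩
    · rintro ⟨h, ⟨h₀, h₁⟩, h₂⟩
      exact ⟨h, h₀.symm, h₁, h₂⟩

/-- The connection points on the top edges of a row of tiles. -/
def rowTop {n : ℕ} (x : Fin n → Tile) : Fin n → Bool := fun j => (x j).top

/-- The connection points on the bottom edges of a row of tiles. -/
def rowBottom {n : ℕ} (x : Fin n → Tile) : Fin n → Bool := fun j => (x j).bottom

theorem isKnotMosaic_iff {m n : ℕ} (M : Fin (m + 1) → Fin (n + 1) → Tile) :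
    IsKnotMosaic M ↔
      (∀ i, IsTileChain Tile.left Tile.right false false (M i)) ∧
        IsTileChain rowTop rowBottom (fun _ => false) (fun _ => false) M := by
  simp only [isTileChain_succ_iff, funext_iff, rowTop, rowBottom]
  constructor
  · rintro ⟨⟨hr, hc⟩, hb⟩
    exact ⟨fun i => ⟨(hb i 0).2.2.1 rfl, fun j => hr i j.castSucc (by simp),
        (hb i (Fin.last n)).2.2.2 (by simp)⟩,
      fun j => (hb 0 j).1 rfl, fun i j => hc i.castSucc j (by simp),
      fun j => (hb (Fin.last m) j).2.1 (by simp)⟩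
  · rintro ⟨hr, ht, hc, hb⟩
    refine ⟨⟨fun i j h => (hr i).2.1 ⟨j, by omega⟩, fun i j h => hc ⟨i, by omega⟩ j⟩,
      fun i j => ⟨fun h => ?_, fun h => ?_, fun h => ?_, fun h => ?_⟩⟩
    · obtain rfl : i = 0 := Fin.ext h
      exact ht j
    · obtain rfl : i = Fin.last m := Fin.ext h
      exact hb j
    · obtain rfl : j = 0 := Fin.ext h
      exact (hr i).1
    · obtain rfl : j = Fin.last n := Fin.ext h
      exact (hr i).2.2

instance : Fintype Tile :=
  ⟨{.T0, .T1, .T2, .T3, .T4, .T5, .T6, .T7, .T8, .T9, .T10}, fun t => by cases t <;> decide⟩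

theorem sum_tile (f : Tile → ℕ) :
    ∑ t, f t = f .T0 + f .T1 + f .T2 + f .T3 + f .T4 + f .T5 + f .T6 + f .T7 + f .T8 + f .T9 +
      f .T10 := by
  rw [show (Finset.univ : Finset Tile) =
    {.T0, .T1, .T2, .T3, .T4, .T5, .T6, .T7, .T8, .T9, .T10} from rfl]
  simp [add_assoc]

theorem sum_fin_cons {α : Type*} [Fintype α] {n : ℕ} (f : (Fin (n + 1) → α) → ℕ) :
    ∑ x, f x = ∑ t, ∑ y : Fin n → α, f (Fin.cons t y : Fin (n + 1) → α) := by
  rw [← (Fin.consEquiv fun _ : Fin (n + 1) => α).sum_comp, Fintype.sum_prod_type]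
  rfl

/-- A table of natural numbers indexed by the boolean words of length `n`. -/
def Table : ℕ → Type
  | 0 => ℕ
  | n + 1 => Table n × Table n

namespace Table

/-- The entry of a table at a given word. -/
def get : {n : ℕ} → Table n → (Fin n → Bool) → ℕ
  | 0, T, _ => T
  | _ + 1, T, s => (bif s 0 then T.2 else T.1).get (Fin.tail s)

/-- Entrywise addition of tables. -/
def add : {n : ℕ} → Table n → Table n → Table n
  | 0, S, T => Nat.add S T
  | _ + 1, S, T => (S.1.add T.1, S.2.add T.2)

/-- Entrywise multiplication by four. -/
def four : {n : ℕ} → Table n → Table n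
  | 0, T => Nat.mul 4 T
  | _ + 1, T => (T.1.four, T.2.four)

/-- The zero table. -/
def zero : (n : ℕ) → Table n
  | 0 => Nat.zero
  | n + 1 => (zero n, zero n)

/-- The table with entry one at the all-`false` word and zero elsewhere. -/
def single : (n : ℕ) → Table n
  | 0 => Nat.succ Nat.zero
  | n + 1 => (single n, zero n)

/-- Transfer of a table through a row of tiles whose left edge has a connection point
according to `l` and whose right edge has none. -/
def transfer : {n : ℕ} → Bool → Table n → Table n
  | 0, false, T => T
  | 0, true, _ => Nat.zero
  | _ + 1, false, T =>
    ((transfer false T.1).add (transfer true T.2), (transfer true T.1).add (transfer false T.2))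
  | _ + 1, true, T =>
    ((transfer true T.1).add (transfer false T.2),
      (transfer false T.1).add (transfer true T.2).four)

@[simp]
theorem get_add {n : ℕ} (S T : Table n) (s : Fin n → Bool) :
    (S.add T).get s = S.get s + T.get s := by
  induction n with
  | zero => rfl
  | succ n ih => cases h : s 0 <;> simp [get, add, h, ih]

@[simp]
theorem get_four {n : ℕ} (T : Table n) (s : Fin n → Bool) : T.four.get s = 4 * T.get s := by
  induction n with
  | zero => rfl
  | succ n ih => cases h : s 0 <;> simp [get, four, h, ih]

@[simp]
theorem get_zero {n : ℕ} (s : Fin n → Bool) : (zero n).get s = 0 := by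
  induction n with
  | zero => rfl
  | succ n ih => cases h : s 0 <;> simp [get, zero, h, ih]

theorem get_single {n : ℕ} (s : Fin n → Bool) :
    (single n).get s = if s = fun _ => false then 1 else 0 := by
  induction n with
  | zero => simp [get, single, Subsingleton.elim s (fun _ => false)]
  | succ n ih =>
    have key : (s = fun _ => false) ↔ s 0 = false ∧ Fin.tail s = fun _ => false := by
      simp [funext_iff, Fin.forall_fin_succ, Fin.tail]
    cases h : s 0 <;> simp [get, single, key, h, ih]

open Classical in
theorem get_transfer {n : ℕ} (l : Bool) (T : Table n) (s : Fin n → Bool) :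
    (T.transfer l).get s =
      ∑ x : Fin n → Tile, if IsTileChain Tile.left Tile.right l false x ∧ rowTop x = s then
        T.get (rowBottom x) else 0 := by
  induction n generalizing l with
  | zero =>
    rw [Fintype.sum_unique]
    cases l <;> simp only [IsTileChain, transfer, get, eq_iff_true_of_subsingleton] <;> rfl
  | succ n ih =>
    have step (t : Tile) (y : Fin n → Tile) :
        (IsTileChain Tile.left Tile.right l false (Fin.cons t y : Fin (n + 1) → Tile) ∧
            rowTop (Fin.cons t y : Fin (n + 1) → Tile) = s) ↔
          (t.left = l ∧ t.top = s 0) ∧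
            (IsTileChain Tile.left Tile.right t.right false y ∧ rowTop y = Fin.tail s) := by
      simp only [IsTileChain, funext_iff, rowTop, Fin.forall_fin_succ, Fin.cons_zero, Fin.cons_succ,
        Fin.tail_cons, Fin.tail]
      tauto
    have bottom (t : Tile) (y : Fin n → Tile) :
        T.get (rowBottom (Fin.cons t y : Fin (n + 1) → Tile)) =
          (bif t.bottom then T.2 else T.1).get (rowBottom y) := rfl
    simp only [sum_fin_cons, step, bottom, ite_and (_ ∧ _)]
    simp only [Finset.sum_ite_irrel, Finset.sum_const_zero, ← ih, sum_tile]
    cases l <;> cases h : s 0 <;>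
      simp [get, transfer, h, Tile.left, Tile.right, Tile.top, Tile.bottom] <;> ring

open Classical in
theorem get_iterate_transfer (m n : ℕ) (s : Fin n → Bool) :
    ((transfer false)^[m] (single n)).get s =
      ∑ M : Fin m → Fin n → Tile,
        if (∀ i, IsTileChain Tile.left Tile.right false false (M i)) ∧
          IsTileChain rowTop rowBottom s (fun _ => false) M then 1 else 0 := by
  induction m generalizing s with
  | zero => simp [IsTileChain, get_single]
  | succ m ih =>
    have step (x : Fin n → Tile) (M : Fin m → Fin n → Tile) :
        ((∀ i, IsTileChain Tile.left Tile.right false false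
            ((Fin.cons x M : Fin (m + 1) → Fin n → Tile) i)) ∧
          IsTileChain rowTop rowBottom s (fun _ => false)
            (Fin.cons x M : Fin (m + 1) → Fin n → Tile)) ↔
          (IsTileChain Tile.left Tile.right false false x ∧ rowTop x = s) ∧
            ((∀ i, IsTileChain Tile.left Tile.right false false (M i)) ∧
              IsTileChain rowTop rowBottom (rowBottom x) (fun _ => false) M) := by
      simp only [IsTileChain, Fin.forall_fin_succ, Fin.cons_zero, Fin.cons_succ, Fin.tail_cons]
      tauto
    simp only [Function.iterate_succ_apply', get_transfer, ih, sum_fin_cons, step,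
      ite_and (_ ∧ _ = _), Finset.sum_ite_irrel, Finset.sum_const_zero]

end Table

theorem knotMosaicCount_eq_get (m n : ℕ) :
    knotMosaicCount (m + 1) (n + 1) =
      ((Table.transfer false)^[m + 1] (Table.single (n + 1))).get fun _ => false := by
  classical
  rw [Table.get_iterate_transfer, knotMosaicCount, Nat.card_eq_fintype_card, Fintype.card_subtype,
    Finset.card_filter]
  simp only [isKnotMosaic_iff]

/-- The number of knot `(6,6)`-mosaics is `D_{6,6} = 101393411126`. -/
theorem knotMosaicCount_six_six : knotMosaicCount 6 6 = 101393411126 := by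
  rw [knotMosaicCount_eq_get]
  decide +kernel
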